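/- Let (x_1,…,x_r) be a sequence of elements of 𝔪 with r < d = dim_R M. Then (x_1,…,x_r) is part of a reducing system of parameters of M if and only if for all i = 1,…,r one has x_i ∉ P for every associated prime P of M/(x_1,…,x_{i−1})M with dim R/P ≥ d − i. -/

import Mathlib

open IsLocalRing

/-- Krull dimension of a module: `dim_R M := dim (R ⧸ Ann_R M)`. -/
noncomputable def moduleDim (R M : Type*) [CommRing R] [AddCommGroup M] [Module R M] :
    WithBot (WithTop ℕ) :=
  ringKrullDim (R ⧸ Module.annihilator R M)

/-- Depth of a module over a local ring: supremum of lengths of regular sequences on `M`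
consisting of elements of the maximal ideal. -/
noncomputable def moduleDepth (R M : Type*) [CommRing R] [IsLocalRing R] [AddCommGroup M]
    [Module R M] : WithBot (WithTop ℕ) :=
  sSup {n : WithBot (WithTop ℕ) | ∃ rs : List R, (rs.length : WithBot (WithTop ℕ)) = n ∧
    (∀ x ∈ rs, x ∈ maximalIdeal R) ∧ RingTheory.Sequence.IsRegular M rs}

/-- `M` is a Cohen–Macaulay module over the local ring `R` iff `depth_R M = dim_R M`. -/
def IsCMModule (R M : Type*) [CommRing R] [IsLocalRing R] [AddCommGroup M] [Module R M] : Prop :=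
  moduleDepth R M = moduleDim R M

/-- `(x 0, …, x (d-1))` is a system of parameters of `M`: the `x i` lie in the maximal ideal,
`d = dim_R M`, and `M ⧸ (x 0, …, x (d-1))M` has finite length. -/
def IsSoP (R M : Type*) [CommRing R] [IsLocalRing R] [AddCommGroup M] [Module R M]
    {d : ℕ} (x : Fin d → R) : Prop :=
  (∀ i, x i ∈ maximalIdeal R) ∧ moduleDim R M = (d : ℕ) ∧
    IsFiniteLength R (M ⧸ (Ideal.span (Set.range x) • (⊤ : Submodule R M)))

/-- A system of parameters `(x 0, …, x (d-1))` of `M` is reducing if for `i = 1, …, d-1`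
(i.e. 0-based indices `i` with `i < d - 1`) the element `x i` avoids all associated primes `P`
of `M ⧸ (x 0, …, x (i-1))M` with `dim R/P = d - (i + 1)`. -/
def IsReducingSoP (R M : Type*) [CommRing R] [IsLocalRing R] [AddCommGroup M] [Module R M]
    {d : ℕ} (x : Fin d → R) : Prop :=
  IsSoP R M x ∧ ∀ i : Fin d, (i : ℕ) < d - 1 →
    ∀ P ∈ associatedPrimes R
      (M ⧸ (Ideal.span (x '' {j : Fin d | (j : ℕ) < (i : ℕ)}) • (⊤ : Submodule R M))),
      ringKrullDim (R ⧸ P) = ((d - ((i : ℕ) + 1) : ℕ) : WithBot (WithTop ℕ)) → x i ∉ P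

/-- `(x 0, …, x (r-1))` is part of a system of parameters of `M`,
i.e. it extends to a system of parameters of `M`. -/
def IsPartSoP (R M : Type*) [CommRing R] [IsLocalRing R] [AddCommGroup M] [Module R M]
    {r : ℕ} (x : Fin r → R) : Prop :=
  ∃ (d : ℕ) (hrd : r ≤ d) (y : Fin d → R), IsSoP R M y ∧ ∀ i : Fin r, y (Fin.castLE hrd i) = x i

/-- `(x 0, …, x (r-1))` is part of a reducing system of parameters of `M`,
i.e. it extends to a reducing system of parameters of `M`. -/
def IsPartReducingSoP (R M : Type*) [CommRing R] [IsLocalRing R] [AddCommGroup M] [Module R M]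
    {r : ℕ} (x : Fin r → R) : Prop :=
  ∃ (d : ℕ) (hrd : r ≤ d) (y : Fin d → R),
    IsReducingSoP R M y ∧ ∀ i : Fin r, y (Fin.castLE hrd i) = x i

section SupportDim

variable {R : Type*} [CommRing R]

theorem Module.supportDim_mono_of_support_subset {N L : Type*} [AddCommGroup N] [Module R N]
    [AddCommGroup L] [Module R L] (h : Module.support R L ⊆ Module.support R N) :
    Module.supportDim R L ≤ Module.supportDim R N :=
  Order.krullDim_le_of_strictMono (Set.inclusion h) fun _ _ hlt => hlt

theorem Module.ringKrullDim_quotient_le_supportDim {N : Type*} [AddCommGroup N] [Module R N]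
    [Module.Finite R N] {P : PrimeSpectrum R} (hP : P ∈ Module.support R N) :
    ringKrullDim (R ⧸ P.asIdeal) ≤ Module.supportDim R N := by
  rw [← Module.supportDim_quotient_eq_ringKrullDim]
  refine Module.supportDim_mono_of_support_subset fun Q hQ => ?_
  rw [Module.mem_support_iff_of_finite, Ideal.annihilator_quotient] at hQ
  exact Module.mem_support_mono hQ hP

theorem mem_support_of_mem_associatedPrimes {N : Type*} [AddCommGroup N] [Module R N]
    [Module.Finite R N] {P : Ideal R} (hP : P ∈ associatedPrimes R N) :
    (⟨P, hP.isPrime⟩ : PrimeSpectrum R) ∈ Module.support R N := by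
  rw [Module.mem_support_iff_of_finite, ← Submodule.annihilator_top]
  exact IsAssociatedPrime.annihilator_le hP

theorem exists_mem_associatedPrimes_le [IsNoetherianRing R] {N : Type*} [AddCommGroup N]
    [Module R N] [Module.Finite R N] {P : PrimeSpectrum R} (hP : P ∈ Module.support R N) :
    ∃ Q ∈ associatedPrimes R N, Q ≤ P.asIdeal := by
  obtain ⟨Q, hQ, hle⟩ :=
    Ideal.exists_minimalPrimes_le (Module.mem_support_iff_of_finite.mp hP)
  exact ⟨Q, Module.associatedPrimes.minimalPrimes_annihilator_subset_associatedPrimes R N hQ, hle⟩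

/-- Cutting the support of a module of dimension at most `n + 1` by an element that avoids all
associated primes of dimension at least `n + 1` lowers the dimension to at most `n`. -/
theorem Module.supportDim_le_of_forall_notMem_associatedPrimes [IsNoetherianRing R]
    {N L : Type*} [AddCommGroup N] [Module R N] [Module.Finite R N]
    [AddCommGroup L] [Module R L] {a : R} {n : ℕ}
    (hs : Module.support R L ⊆ Module.support R N ∩ PrimeSpectrum.zeroLocus {a})
    (hN : Module.supportDim R N ≤ (n + 1 : ℕ))
    (ha : ∀ P ∈ associatedPrimes R N, ((n + 1 : ℕ) : WithBot ℕ∞) ≤ ringKrullDim (R ⧸ P) → a ∉ P) :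
    Module.supportDim R L ≤ (n : ℕ) := by
  refine iSup_le fun p => ?_
  have hp := hs p.head.2
  have hap : a ∈ p.head.1.asIdeal := by simpa using hp.2
  obtain ⟨Q, hQ, hle⟩ := exists_mem_associatedPrimes_le hp.1
  let q : LTSeries (Module.support R N) :=
    p.map (Set.inclusion fun P hP => (hs hP).1) fun _ _ h => h
  let Q' : Module.support R N := ⟨⟨Q, hQ.isPrime⟩, mem_support_of_mem_associatedPrimes hQ⟩
  obtain hlt | heq := lt_or_eq_of_le (show Q' ≤ q.head from hle)
  · have h : (((q.cons Q' hlt).length : ℕ) : WithBot ℕ∞) ≤ (n + 1 : ℕ) :=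
      (le_iSup (fun s : LTSeries (Module.support R N) => (s.length : WithBot ℕ∞)) _).trans hN
    have h' : (q.cons Q' hlt).length ≤ n + 1 := Nat.cast_le.mp h
    have h'' : (q.cons Q' hlt).length = p.length + 1 := RelSeries.cons_length ..
    exact Nat.cast_le.mpr (by omega)
  · have hQa : a ∈ Q := by
      have : Q = p.head.1.asIdeal := congrArg (fun z => z.1.asIdeal) heq
      rwa [this]
    have hlt : ringKrullDim (R ⧸ Q) < (n + 1 : ℕ) := not_le.mp fun h => ha Q hQ h hQa
    have hlen : ((p.length : ℕ) : WithBot ℕ∞) ≤ ringKrullDim (R ⧸ Q) := by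
      rw [ringKrullDim_quotient]
      let s : LTSeries (PrimeSpectrum.zeroLocus (Q : Set R)) :=
        { length := p.length
          toFun := fun i => ⟨(p i).1, by
            have h1 : p.head ≤ p i := p.monotone (Fin.zero_le i)
            exact le_trans hle (show p.head.1.asIdeal ≤ (p i).1.asIdeal from h1)⟩
          step := fun i => p.step i }
      exact le_iSup (fun s : LTSeries (PrimeSpectrum.zeroLocus (Q : Set R)) =>
        (s.length : WithBot ℕ∞)) s
    have := Nat.cast_lt.mp (hlen.trans_lt hlt)
    exact Nat.cast_le.mpr (by omega)

theorem Module.supportDim_le_zero_of_isFiniteLength [IsNoetherianRing R] {N : Type*}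
    [AddCommGroup N] [Module R N] [Module.Finite R N] (h : IsFiniteLength R N) :
    Module.supportDim R N ≤ 0 := by
  obtain ⟨_, _⟩ := isFiniteLength_iff_isNoetherian_isArtinian.mp h
  refine Order.krullDim_nonpos_iff_forall_isMax.mpr fun P P' hle => ?_
  obtain ⟨Q, hQ, hQP⟩ := exists_mem_associatedPrimes_le P.2
  obtain ⟨hprime, f, hf⟩ := (isAssociatedPrime_iff_exists_injective_linearMap Q N).mp hQ
  have : IsArtinian R (R ⧸ Q) := isArtinian_of_injective f hf
  have : IsArtinianRing (R ⧸ Q) := isArtinian_of_tower R this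
  have hmax : Q.IsMaximal :=
    Ideal.Quotient.maximal_of_isField _ (IsArtinianRing.isField_of_isDomain _)
  have h2 : Q = P'.1.asIdeal :=
    hmax.eq_of_le P'.1.2.ne_top (hQP.trans hle)
  exact h2.symm.le.trans hQP

theorem isFiniteLength_of_supportDim_le_zero [IsNoetherianRing R] {N : Type*}
    [AddCommGroup N] [Module R N] [Module.Finite R N] (h : Module.supportDim R N ≤ 0) :
    IsFiniteLength R N := by
  rw [Module.supportDim_eq_ringKrullDim_quotient_annihilator] at h
  have : IsArtinianRing (R ⧸ Module.annihilator R N) :=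
    isArtinianRing_iff_krullDimLE_zero.mpr (Ring.krullDimLE_iff.mpr (by simpa using h))
  let _ : Module (R ⧸ Module.annihilator R N) N := Module.quotientAnnihilator
  have : IsScalarTower R (R ⧸ Module.annihilator R N) N :=
    Module.IsTorsionBySet.isScalarTower _
  have : Module.Finite (R ⧸ Module.annihilator R N) N :=
    Module.Finite.of_restrictScalars_finite R _ _
  have : IsArtinian (R ⧸ Module.annihilator R N) N := inferInstance
  have : IsArtinian R N :=
    isArtinian_of_surjective_algebraMap (R := R ⧸ Module.annihilator R N)
      Ideal.Quotient.mk_surjective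
  exact isFiniteLength_iff_isNoetherian_isArtinian.mpr ⟨inferInstance, this⟩

end SupportDim

section InitialTerms

variable {R : Type*} [CommRing R]

/-- The ideal generated by the first `k` terms of a sequence. -/
def initialIdeal (y : ℕ → R) (k : ℕ) : Ideal R :=
  Ideal.span (y '' Set.Iio k)

theorem initialIdeal_congr {y z : ℕ → R} {k : ℕ} (h : ∀ i < k, y i = z i) :
    initialIdeal y k = initialIdeal z k :=
  congrArg Ideal.span (Set.image_congr h)

/-- Extension by zero of a finite sequence. -/
def extendZero {n : ℕ} (x : Fin n → R) (k : ℕ) : R :=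
  if h : k < n then x ⟨k, h⟩ else 0

theorem extendZero_apply {n : ℕ} (x : Fin n → R) (i : Fin n) : extendZero x i = x i := by
  simp [extendZero]

theorem initialIdeal_eq_span_fin {n : ℕ} {y : ℕ → R} {x : Fin n → R} (h : ∀ i : Fin n, y i = x i)
    {k : ℕ} (hk : k ≤ n) :
    initialIdeal y k = Ideal.span (x '' {j : Fin n | (j : ℕ) < k}) := by
  refine congrArg Ideal.span (Set.ext fun a => ⟨?_, ?_⟩)
  · rintro ⟨j, hj, rfl⟩
    exact ⟨⟨j, lt_of_lt_of_le hj hk⟩, hj, (h _).symm⟩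
  · rintro ⟨j, hj, rfl⟩
    exact ⟨j, hj, h j⟩

theorem initialIdeal_eq_span_range {n : ℕ} {y : ℕ → R} {x : Fin n → R}
    (h : ∀ i : Fin n, y i = x i) : initialIdeal y n = Ideal.span (Set.range x) := by
  rw [initialIdeal_eq_span_fin h le_rfl]
  congr 1
  ext a
  simp

variable (M : Type*) [AddCommGroup M] [Module R M]

/-- The quotient of `M` by the first `k` terms of a sequence. -/
abbrev InitialQuotient (y : ℕ → R) (k : ℕ) : Type _ :=
  M ⧸ (initialIdeal y k • (⊤ : Submodule R M))

theorem supportDim_initialQuotient_zero (y : ℕ → R) :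
    Module.supportDim R (InitialQuotient M y 0) ≤ Module.supportDim R M :=
  Module.supportDim_le_of_surjective _ (Submodule.mkQ_surjective _)

variable [Module.Finite R M]

theorem support_initialQuotient_succ (y : ℕ → R) (k : ℕ) :
    Module.support R (InitialQuotient M y (k + 1)) =
      Module.support R (InitialQuotient M y k) ∩ PrimeSpectrum.zeroLocus {y k} := by
  have h : (Set.Iio (k + 1) : Set ℕ) = insert k (Set.Iio k) := by
    ext; simp
  rw [Module.support_quotient, Module.support_quotient, Set.inter_assoc]
  simp only [initialIdeal, PrimeSpectrum.zeroLocus_span]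
  rw [h, Set.image_insert_eq, ← Set.union_singleton, PrimeSpectrum.zeroLocus_union]

variable [IsNoetherianRing R]

theorem supportDim_initialQuotient_le_of_forall_notMem {d : ℕ}
    (hd : Module.supportDim R M ≤ (d : ℕ)) {y : ℕ → R} {k : ℕ} (hk : k ≤ d)
    (hy : ∀ i < k, ∀ P ∈ associatedPrimes R (InitialQuotient M y i),
      ((d - i : ℕ) : WithBot ℕ∞) ≤ ringKrullDim (R ⧸ P) → y i ∉ P) :
    Module.supportDim R (InitialQuotient M y k) ≤ (d - k : ℕ) := by
  induction k with
  | zero => exact (supportDim_initialQuotient_zero M y).trans hd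
  | succ k ih =>
    have hs : d - k = d - (k + 1) + 1 := by omega
    have ih := ih (by omega) fun i hi => hy i (by omega)
    have hyk := hy k (by omega)
    rw [hs] at ih hyk
    exact Module.supportDim_le_of_forall_notMem_associatedPrimes
      (support_initialQuotient_succ M y k).subset ih hyk

variable [IsLocalRing R]

theorem supportDim_initialQuotient_le_succ {y : ℕ → R} {k : ℕ} (hy : y k ∈ maximalIdeal R) :
    Module.supportDim R (InitialQuotient M y k) ≤
      Module.supportDim R (InitialQuotient M y (k + 1)) + 1 := by
  refine (Module.supportDim_le_supportDim_quotSMulTop_succ hy).trans ?_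
  gcongr
  refine Module.supportDim_mono_of_support_subset ?_
  rw [support_initialQuotient_succ, Module.support_quotSMulTop]

theorem supportDim_initialQuotient_le_of_isFiniteLength {d : ℕ} {y : ℕ → R}
    (hy : ∀ i < d, y i ∈ maximalIdeal R) (hfin : IsFiniteLength R (InitialQuotient M y d))
    {k : ℕ} (hk : k ≤ d) :
    Module.supportDim R (InitialQuotient M y k) ≤ (d - k : ℕ) := by
  induction hk using Nat.decreasingInduction with
  | self => simpa using Module.supportDim_le_zero_of_isFiniteLength hfin
  | of_succ k hk ih =>
    have hs : d - k = d - (k + 1) + 1 := by omega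
    refine (supportDim_initialQuotient_le_succ M (hy k hk)).trans ?_
    rw [hs, Nat.cast_add, Nat.cast_one]
    gcongr

theorem exists_mem_maximalIdeal_forall_notMem_associatedPrimes (N : Type*) [AddCommGroup N]
    [Module R N] [Module.Finite R N] :
    ∃ a ∈ maximalIdeal R, ∀ P ∈ associatedPrimes R N, P ≠ maximalIdeal R → a ∉ P := by
  by_contra! h
  have hfin : {P ∈ associatedPrimes R N | P ≠ maximalIdeal R}.Finite :=
    (associatedPrimes.finite R N).subset fun P hP => hP.1
  obtain ⟨P, hP, hle⟩ := (Ideal.subset_union_prime_finite hfin (f := id) ⊥ ⊥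
    (fun P hP _ _ => hP.1.isPrime) (I := maximalIdeal R)).mp fun a ha => by
      obtain ⟨P, hP, hne, haP⟩ := h a ha
      exact Set.mem_biUnion (show P ∈ {P ∈ associatedPrimes R N | P ≠ maximalIdeal R} from
        ⟨hP, hne⟩) haP
  exact hP.2 (le_antisymm (IsLocalRing.le_maximalIdeal hP.1.isPrime.ne_top) hle)

/-- A sequence in the maximal ideal can be continued, from the `r`-th term on, by elements
avoiding the nonmaximal associated primes of the successive quotients. -/
theorem exists_extension_forall_notMem_associatedPrimes {r : ℕ} (x : ℕ → R)
    (hx : ∀ i < r, x i ∈ maximalIdeal R) (k : ℕ) :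
    ∃ y : ℕ → R, (∀ i < r, y i = x i) ∧ (∀ i < r + k, y i ∈ maximalIdeal R) ∧
      ∀ i, r ≤ i → i < r + k → ∀ P ∈ associatedPrimes R (InitialQuotient M y i),
        P ≠ maximalIdeal R → y i ∉ P := by
  induction k with
  | zero => exact ⟨x, fun _ _ => rfl, hx, fun i h h' => by omega⟩
  | succ k ih =>
    obtain ⟨y, hyx, hym, hy⟩ := ih
    obtain ⟨a, ham, ha⟩ :=
      exists_mem_maximalIdeal_forall_notMem_associatedPrimes (R := R)
        (InitialQuotient M y (r + k))
    have hne : ∀ i < r + k, Function.update y (r + k) a i = y i := fun i hi =>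
      Function.update_of_ne (by omega) _ _
    have hpre : ∀ i ≤ r + k, initialIdeal (Function.update y (r + k) a) i = initialIdeal y i :=
      fun i hi => initialIdeal_congr fun j hj => hne j (by omega)
    refine ⟨Function.update y (r + k) a, fun i hi => ?_, fun i hi => ?_, fun i hri hi => ?_⟩
    · rw [hne i (by omega), hyx i hi]
    · obtain h | rfl := Nat.lt_succ_iff_lt_or_eq.mp (show i < (r + k) + 1 by omega)
      · rw [hne i h]
        exact hym i h
      · simpa using ham
    · change ∀ P ∈ associatedPrimes R (M ⧸ (initialIdeal _ i • (⊤ : Submodule R M))), _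
      rw [hpre i (by omega)]
      obtain h | rfl := Nat.lt_succ_iff_lt_or_eq.mp (show i < (r + k) + 1 by omega)
      · rw [hne i h]
        exact hy i hri h
      · simpa using ha

end InitialTerms

theorem moduleDim_eq_supportDim (R M : Type*) [CommRing R] [AddCommGroup M] [Module R M]
    [Module.Finite R M] : moduleDim R M = Module.supportDim R M :=
  (Module.supportDim_eq_ringKrullDim_quotient_annihilator (R := R) (M := M)).symm

theorem ne_maximalIdeal_of_one_le_ringKrullDim {R : Type*} [CommRing R] [IsLocalRing R]
    {P : Ideal R} {n : ℕ} (hn : 1 ≤ n) (h : (n : WithBot ℕ∞) ≤ ringKrullDim (R ⧸ P)) :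
    P ≠ maximalIdeal R := by
  rintro rfl
  have h0 : ringKrullDim (R ⧸ maximalIdeal R) = 0 :=
    ringKrullDim_eq_zero_of_isField
      ((Ideal.Quotient.maximal_ideal_iff_isField_quotient _).mp inferInstance)
  rw [h0] at h
  have h' : ((n : ℕ) : WithBot ℕ∞) ≤ ((0 : ℕ) : WithBot ℕ∞) := h
  exact absurd (Nat.cast_le.mp h') (by omega)

theorem stmt12 (R M : Type*) [CommRing R] [IsLocalRing R] [IsNoetherianRing R]
    [AddCommGroup M] [Module R M] [Module.Finite R M] [Nontrivial M]
    {d r : ℕ} (hd : moduleDim R M = (d : ℕ)) (hr : r < d)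
    (x : Fin r → R) (hx : ∀ i, x i ∈ maximalIdeal R) :
    IsPartReducingSoP R M x ↔
      ∀ i : Fin r, ∀ P ∈ associatedPrimes R
        (M ⧸ (Ideal.span (x '' {j : Fin r | (j : ℕ) < (i : ℕ)}) • (⊤ : Submodule R M))),
        ((d - ((i : ℕ) + 1) : ℕ) : WithBot (WithTop ℕ)) ≤ ringKrullDim (R ⧸ P) → x i ∉ P := by
  have hd' : Module.supportDim R M = (d : ℕ) := (moduleDim_eq_supportDim R M).symm.trans hd
  constructor
  · rintro ⟨d', hrd, y, ⟨⟨hym, hyd, hyfin⟩, hred⟩, hyx⟩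
    obtain rfl : d = d' := Nat.cast_injective (R := WithBot ℕ∞) (hd.symm.trans hyd)
    have hy : ∀ i : Fin d, extendZero y i = y i := extendZero_apply y
    have hx' : ∀ i : Fin r, extendZero y i = x i := fun i =>
      (hy (Fin.castLE hrd i)).trans (hyx i)
    intro i P hP hdim hxP
    have hid : (i : ℕ) < d := i.2.trans hr
    rw [← initialIdeal_eq_span_fin hx' i.2.le] at hP
    refine hred ⟨i, hid⟩ (by simp only; omega) P ?_ (le_antisymm ?_ hdim) ?_
    · rwa [← initialIdeal_eq_span_fin hy hid.le]
    · rw [← initialIdeal_eq_span_range hy] at hyfin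
      refine le_trans ?_ (supportDim_initialQuotient_le_of_isFiniteLength M
        (fun j hj => (hy ⟨j, hj⟩).symm ▸ hym ⟨j, hj⟩) hyfin (Nat.succ_le_of_lt hid))
      refine Module.ringKrullDim_quotient_le_supportDim (P := ⟨P, hP.isPrime⟩) ?_
      refine (support_initialQuotient_succ M (extendZero y) i).superset ?_
      exact ⟨mem_support_of_mem_associatedPrimes hP, by simpa [hx' i] using hxP⟩
    · exact (hyx i).symm ▸ hxP
  · intro h
    obtain ⟨y, hyx, hym, hy⟩ := exists_extension_forall_notMem_associatedPrimes M (extendZero x)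
      (r := r) (fun i hi => (extendZero_apply x ⟨i, hi⟩).symm ▸ hx ⟨i, hi⟩) (d - r)
    rw [Nat.add_sub_cancel' hr.le] at hym hy
    have hyx' : ∀ i : Fin r, y i = x i := fun i => (hyx i i.2).trans (extendZero_apply x i)
    have havoid : ∀ i < d, ∀ P ∈ associatedPrimes R (InitialQuotient M y i),
        P ≠ maximalIdeal R → ((d - (i + 1) : ℕ) : WithBot ℕ∞) ≤ ringKrullDim (R ⧸ P) →
        y i ∉ P := by
      intro i hid P hP hPm hdim
      obtain hir | hri := lt_or_ge i r
      · refine (hyx' ⟨i, hir⟩).symm ▸ h ⟨i, hir⟩ P ?_ hdim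
        rwa [← initialIdeal_eq_span_fin hyx' hir.le]
      · exact hy i hri hid P hP hPm
    refine ⟨d, hr.le, fun i => y i, ⟨⟨fun i => hym i i.2, hd, ?_⟩, ?_⟩, hyx'⟩
    · rw [← initialIdeal_eq_span_range (y := y) (fun _ => rfl)]
      refine isFiniteLength_of_supportDim_le_zero ?_
      have := supportDim_initialQuotient_le_of_forall_notMem M hd'.le (y := y) (le_refl d)
        fun i hi P hP hdim => havoid i hi P hP
          (ne_maximalIdeal_of_one_le_ringKrullDim (by omega) hdim)
          (le_trans (Nat.cast_le.mpr (by omega)) hdim)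
      simpa using this
    · intro i hi P hP hdim
      rw [← initialIdeal_eq_span_fin (y := y) (fun _ => rfl) i.2.le] at hP
      exact havoid i i.2 P hP (ne_maximalIdeal_of_one_le_ringKrullDim (by omega) hdim.ge) hdim.ge
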